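/- Let V be a complete lattice containing at least two distinct elements, equipped with a binary operation ⊗ that is commutative, associative, monotone in each argument, and has a unit element 1. Then V cannot simultaneously be closed (i.e. admit a binary operation [-,-] on V such that x ⊗ y ≤ z if and only if x ≤ [y,z], for all x, y, z), strongly epistemically conservative (i.e. x ≤ x ⊗ y for all x, y), and cancellative (i.e. x ⊗ z ≤ y ⊗ z implies x ≤ y, for all x, y, z). -/

import Mathlib

/-- A complete (complete lattice) non-trivial epistemic calculus cannot be
closed, strongly epistemically conservative and cancellative simultaneously. -/
theorem no_go_closed_conservative_cancellative
    {V : Type*} [CompleteLattice V] (hnontriv : ∃ a b : V, a ≠ b)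
    (op : V → V → V) (one : V)
    (hcomm : ∀ x y : V, op x y = op y x)
    (hassoc : ∀ x y z : V, op (op x y) z = op x (op y z))
    (hmono : ∀ x y z w : V, x ≤ y → z ≤ w → op x z ≤ op y w)
    (hunit : ∀ x : V, op x one = x) :
    ¬ ((∃ hom : V → V → V, ∀ x y z : V, op x y ≤ z ↔ x ≤ hom y z) ∧
       (∀ x y : V, x ≤ op x y) ∧
       (∀ x y z : V, op x z ≤ op y z → x ≤ y)) := by
  rintro ⟨⟨hom, hadj⟩, -, hcancel⟩
  obtain ⟨a, b, hab⟩ := hnontriv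
  have hbot : ∀ x : V, op x ⊥ ≤ ⊥ := fun x => by
    rw [hcomm]
    exact (hadj ⊥ x ⊥).2 bot_le
  have hle : ∀ x y : V, x ≤ y := fun x y => hcancel x y ⊥ ((hbot x).trans bot_le)
  exact hab (le_antisymm (hle a b) (hle b a))
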